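/- arXiv:2105.11888 — 4 statements merged into one kernel-verified Lean document; each statement's English description precedes it below -/
import Mathlib

section
/- Let p* be a start–goal path that is lexicographically minimal in (cost₁, cost₂) among all start–goal paths, and set ub₂ := cost₂(p*). Let s ∈ S and let ℓf, ℓb ∈ ℝ satisfy ℓf ≤ cost₂(p) for every start–s path p and ℓb ≤ cost₂(r) for every s–goal path r. If ℓf + ℓb > ub₂, then every start–goal path that passes through s is dominated by p*; in particular, s lies on no Pareto-optimal start–goal path other than (possibly) paths with the same cost pair as p* — in fact every path through s is dominated, so s lies on no Pareto-optimal start–goal path. -/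
/-- A path from `u` to `v` in the directed graph with edge relation `E`:
a nonempty list of states starting at `u`, ending at `v`, with consecutive
states related by `E`. -/
def IsPath {S : Type*} (E : S → S → Prop) (u v : S) (l : List S) : Prop :=
  l ≠ [] ∧ l.head? = some u ∧ l.getLast? = some v ∧ l.Chain' E

/-- The cost of a path: the sum of the edge costs `c` over consecutive pairs. -/
noncomputable def pathCost {S : Type*} (c : S → S → ℝ) (l : List S) : ℝ :=
  ((l.zip l.tail).map fun e => c e.1 e.2).sum

/-- The cost pair of a path. -/
noncomputable def costPair {S : Type*} (c₁ c₂ : S → S → ℝ) (l : List S) : ℝ × ℝ :=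
  (pathCost c₁ l, pathCost c₂ l)

/-- `(a₁, a₂)` dominates `(b₁, b₂)` if `a₁ < b₁ ∧ a₂ ≤ b₂` or `a₁ = b₁ ∧ a₂ < b₂`. -/
def Dominates (a b : ℝ × ℝ) : Prop :=
  (a.1 < b.1 ∧ a.2 ≤ b.2) ∨ (a.1 = b.1 ∧ a.2 < b.2)

/-- `(a₁, a₂)` weakly dominates `(b₁, b₂)` if `a₁ ≤ b₁ ∧ a₂ ≤ b₂`. -/
def WeaklyDominates (a b : ℝ × ℝ) : Prop :=
  a.1 ≤ b.1 ∧ a.2 ≤ b.2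

/-- Concatenation of a path ending at `s` with a path starting at `s`. -/
def pathConcat {S : Type*} (p q : List S) : List S := p ++ q.tail

theorem pathCost_append_cons {S : Type*} (c : S → S → ℝ) (a : List S) (s : S) (b : List S) :
    pathCost c (a ++ s :: b) = pathCost c (a ++ [s]) + pathCost c (s :: b) := by
  induction a with
  | nil => simp [pathCost]
  | cons x a ih =>
    cases a with
    | nil => simp [pathCost]
    | cons y a =>
      simp only [pathCost, List.cons_append, List.tail_cons, List.zip_cons_cons, List.map_cons,
        List.sum_cons] at ih ⊢
      rw [ih, add_assoc]

theorem IsPath.split {S : Type*} {E : S → S → Prop} {u v s : S} {a b : List S}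
    (h : IsPath E u v (a ++ s :: b)) :
    IsPath E u s (a ++ [s]) ∧ IsPath E s v (s :: b) := by
  obtain ⟨-, hu, hv, hc⟩ := h
  obtain ⟨hca, hcb⟩ := List.isChain_split.mp hc
  refine ⟨⟨by simp, ?_, by simp, hca⟩, by simp, rfl, ?_, hcb⟩
  · cases a <;> simpa using hu
  · simpa using hv

/-- if `pstar` is lexicographically minimal in `(cost₁, cost₂)`
and the sum of admissible lower bounds on the secondary costs of start–s and
s–goal paths exceeds `ub₂ = cost₂ pstar`, then every start–goal path through `s`
is dominated by `pstar`, so `s` lies on no Pareto-optimal start–goal path. -/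
theorem out_of_secondary_bound_states_on_no_solution_path
    {S : Type*} (E : S → S → Prop) (c₁ c₂ : S → S → ℝ)
    (hnn : ∀ u v, E u v → 0 ≤ c₁ u v ∧ 0 ≤ c₂ u v)
    (start goal : S)
    (pstar : List S) (hps : IsPath E start goal pstar)
    (hlex : ∀ r, IsPath E start goal r →
        pathCost c₁ pstar < pathCost c₁ r ∨
        (pathCost c₁ pstar = pathCost c₁ r ∧ pathCost c₂ pstar ≤ pathCost c₂ r))
    (s : S) (ℓf ℓb : ℝ)
    (hf : ∀ p, IsPath E start s p → ℓf ≤ pathCost c₂ p)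
    (hb : ∀ r, IsPath E s goal r → ℓb ≤ pathCost c₂ r)
    (hgt : pathCost c₂ pstar < ℓf + ℓb) :
    (∀ P, IsPath E start goal P → s ∈ P →
        Dominates (costPair c₁ c₂ pstar) (costPair c₁ c₂ P)) ∧
    (∀ P, IsPath E start goal P →
        (∀ r, IsPath E start goal r →
          ¬ Dominates (costPair c₁ c₂ r) (costPair c₁ c₂ P)) →
        s ∉ P) := by
  have key : ∀ P, IsPath E start goal P → s ∈ P →
      Dominates (costPair c₁ c₂ pstar) (costPair c₁ c₂ P) := by
    intro P hP hs
    obtain ⟨a, b, rfl⟩ := List.append_of_mem hs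
    have hlt : pathCost c₂ pstar < pathCost c₂ (a ++ s :: b) := by
      rw [pathCost_append_cons]
      linarith [hf _ hP.split.1, hb _ hP.split.2]
    exact (hlex _ hP).imp (fun h => ⟨h, hlt.le⟩) fun h => ⟨h.1, hlt⟩
  exact ⟨key, fun P hP hopt hs => hopt pstar hps (key P hP hs)⟩
end

section
/- Let n ∈ ℕ and let (a, b) : Fin n → ℝ × ℝ be a finite sequence of cost pairs such that a is monotone nondecreasing (i ≤ j implies a i ≤ a j) and b is strictly decreasing (i < j implies b j < b i). Then for indices i ≠ j, the pair (a j, b j) dominates the pair (a i, b i) if and only if i < j and a i = a j. Consequently, the pair at index i is not dominated by any other pair in the sequence if and only if a i < a j for every j > i (equivalently, i is the last index attaining the value a i). -/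
/-- With nondecreasing first and strictly decreasing second components, dominance happens exactly
between a pair and a later one with the same first component. -/
theorem dominates_iff_of_monotone_of_strictAnti {ι : Type*} [LinearOrder ι] {a b : ι → ℝ}
    (ha : Monotone a) (hb : StrictAnti b) (i j : ι) :
    Dominates (a j, b j) (a i, b i) ↔ i < j ∧ a i = a j := by
  constructor
  · rintro (⟨h₁, h₂⟩ | ⟨h₁, h₂⟩)
    · exact absurd (ha (hb.le_iff_ge.mp h₂)) h₁.not_ge
    · exact ⟨hb.lt_iff_gt.mp h₂, h₁.symm⟩
  · rintro ⟨hij, h⟩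
    exact Or.inr ⟨h.symm, hb hij⟩

/-- in a sequence of cost pairs with nondecreasing first component
and strictly decreasing second component, the pair at index `j` dominates the
pair at index `i ≠ j` iff `i < j` and `a i = a j`; hence the pair at `i` is
non-dominated iff `a i < a j` for every `j > i`. -/
theorem dominance_in_monotone_sequence
    (n : ℕ) (a b : Fin n → ℝ)
    (ha : Monotone a) (hb : StrictAnti b) :
    (∀ i j : Fin n, i ≠ j →
        (Dominates (a j, b j) (a i, b i) ↔ i < j ∧ a i = a j)) ∧
    (∀ i : Fin n,
        (∀ j : Fin n, j ≠ i → ¬ Dominates (a j, b j) (a i, b i)) ↔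
        (∀ j : Fin n, i < j → a i < a j)) := by
  refine ⟨fun i j _ => dominates_iff_of_monotone_of_strictAnti ha hb i j, fun i => ?_⟩
  simp only [dominates_iff_of_monotone_of_strictAnti ha hb, not_and]
  exact ⟨fun h j hij => (ha hij.le).lt_of_ne (h j hij.ne' hij),
    fun h j _ hij => (h j hij).ne⟩
end

section
/- Fix bounds B₁, B₂ ∈ ℝ, a state s ∈ S, and real numbers h₁ᵇ, h₂ᵇ such that h₁ᵇ ≤ cost₁(r) and h₂ᵇ ≤ cost₂(r) for every s–goal path r (admissible lower bounds on complementary costs). Call a start–s path p' valid if cost₁(p') + h₁ᵇ < B₁ and cost₂(p') + h₂ᵇ < B₂, and suppose m ∈ ℝ satisfies m ≤ cost₁(p') for every valid start–s path p'. Then every start–goal path P with cost₁(P) < B₁ and cost₂(P) < B₂ that passes through s has a valid start–s prefix, and therefore the first cost of its start–s prefix is at least m. In particular, m is an admissible lower bound on the first cost of reaching s along any start–goal path whose cost pair lies strictly within the bounds (B₁, B₂). -/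
/-- A path split at an occurrence of `s` has a prefix path ending at `s`. -/
theorem IsPath.prefix_of_append_cons {S : Type*} {E : S → S → Prop} {u v s : S} {a b : List S}
    (h : IsPath E u v (a ++ s :: b)) : IsPath E u s (a ++ [s]) := by
  obtain ⟨-, hhead, -, hchain⟩ := h
  refine ⟨by simp, ?_, by simp, (List.isChain_split.1 hchain).1⟩
  cases a <;> simpa using hhead

/-- A path split at an occurrence of `s` has a suffix path starting at `s`. -/
theorem IsPath.suffix_of_append_cons {S : Type*} {E : S → S → Prop} {u v s : S} {a b : List S}
    (h : IsPath E u v (a ++ s :: b)) : IsPath E s v (s :: b) := by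
  obtain ⟨-, -, hlast, hchain⟩ := h
  exact ⟨by simp, by simp, by simpa using hlast, (List.isChain_split.1 hchain).2⟩

/-- heuristic tuning, Lemma 4: given admissible lower bounds
`h₁b, h₂b` on the complementary costs from `s`, call a start–s path valid if its
cost plus the bound stays strictly below `(B₁, B₂)`. If `m` lower-bounds the
first cost of every valid start–s path, then every in-bounds start–goal path
through `s` has a valid start–s prefix, whose first cost is at least `m`. -/
theorem tuned_secondary_heuristic_admissible
    {S : Type*} (E : S → S → Prop) (c₁ c₂ : S → S → ℝ)
    (hnn : ∀ u v, E u v → 0 ≤ c₁ u v ∧ 0 ≤ c₂ u v)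
    (start goal : S) (B₁ B₂ : ℝ) (s : S) (h₁b h₂b : ℝ)
    (hh₁ : ∀ r, IsPath E s goal r → h₁b ≤ pathCost c₁ r)
    (hh₂ : ∀ r, IsPath E s goal r → h₂b ≤ pathCost c₂ r)
    (m : ℝ)
    (hm : ∀ p', IsPath E start s p' →
        pathCost c₁ p' + h₁b < B₁ → pathCost c₂ p' + h₂b < B₂ →
        m ≤ pathCost c₁ p') :
    ∀ P, IsPath E start goal P →
      pathCost c₁ P < B₁ → pathCost c₂ P < B₂ → s ∈ P →
      ∃ p', p' <+: P ∧ IsPath E start s p' ∧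
        pathCost c₁ p' + h₁b < B₁ ∧ pathCost c₂ p' + h₂b < B₂ ∧
        m ≤ pathCost c₁ p' := by
  intro P hP hP₁ hP₂ hs
  obtain ⟨a, b, rfl⟩ := List.append_of_mem hs
  have hpre := hP.prefix_of_append_cons
  have hsuf := hP.suffix_of_append_cons
  rw [pathCost_append_cons] at hP₁ hP₂
  have hv₁ : pathCost c₁ (a ++ [s]) + h₁b < B₁ := by linarith [hh₁ _ hsuf]
  have hv₂ : pathCost c₂ (a ++ [s]) + h₂b < B₂ := by linarith [hh₂ _ hsuf]
  exact ⟨a ++ [s], ⟨b, by simp⟩, hpre, hv₁, hv₂, hm _ hpre hv₁ hv₂⟩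
end

section
/- Let p₁ be a start–goal path that is lexicographically minimal in (cost₁, cost₂) among all start–goal paths, and let p₂ be a start–goal path that is lexicographically minimal in (cost₂, cost₁) among all start–goal paths. Then every Pareto-optimal start–goal path p whose cost pair differs from both the cost pair of p₁ and the cost pair of p₂ satisfies cost₁(p₁) < cost₁(p) < cost₁(p₂) and cost₂(p₂) < cost₂(p) < cost₂(p₁). -/
/-- every Pareto-optimal start–goal path whose cost pair differs
from the cost pairs of the two lexicographically optimal paths `p₁` (lex-min in
`(cost₁, cost₂)`) and `p₂` (lex-min in `(cost₂, cost₁)`) lies strictly inside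
the box determined by them. -/
theorem pareto_solutions_strictly_inside_bounds
    {S : Type*} (E : S → S → Prop) (c₁ c₂ : S → S → ℝ)
    (hnn : ∀ u v, E u v → 0 ≤ c₁ u v ∧ 0 ≤ c₂ u v)
    (start goal : S)
    (p₁ : List S) (hp₁ : IsPath E start goal p₁)
    (hlex₁ : ∀ r, IsPath E start goal r →
        pathCost c₁ p₁ < pathCost c₁ r ∨
        (pathCost c₁ p₁ = pathCost c₁ r ∧ pathCost c₂ p₁ ≤ pathCost c₂ r))
    (p₂ : List S) (hp₂ : IsPath E start goal p₂)
    (hlex₂ : ∀ r, IsPath E start goal r →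
        pathCost c₂ p₂ < pathCost c₂ r ∨
        (pathCost c₂ p₂ = pathCost c₂ r ∧ pathCost c₁ p₂ ≤ pathCost c₁ r))
    (p : List S) (hp : IsPath E start goal p)
    (hpareto : ∀ r, IsPath E start goal r →
        ¬ Dominates (costPair c₁ c₂ r) (costPair c₁ c₂ p))
    (hne₁ : costPair c₁ c₂ p ≠ costPair c₁ c₂ p₁)
    (hne₂ : costPair c₁ c₂ p ≠ costPair c₁ c₂ p₂) :
    pathCost c₁ p₁ < pathCost c₁ p ∧ pathCost c₁ p < pathCost c₁ p₂ ∧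
    pathCost c₂ p₂ < pathCost c₂ p ∧ pathCost c₂ p < pathCost c₂ p₁ := by
  have h₁ := hpareto p₁ hp₁
  have h₂ := hpareto p₂ hp₂
  simp only [Dominates, costPair, not_or, not_and, not_le, not_lt] at h₁ h₂
  simp only [costPair, ne_eq, Prod.mk.injEq, not_and] at hne₁ hne₂
  have lt₁ : pathCost c₁ p₁ < pathCost c₁ p :=
    (hlex₁ p hp).elim id fun ⟨h, h'⟩ => absurd (le_antisymm (h₁.2 h) h') (hne₁ h.symm)
  have lt₂ : pathCost c₂ p₂ < pathCost c₂ p :=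
    (hlex₂ p hp).elim id fun ⟨h, h'⟩ =>
      absurd h.symm (hne₂ (le_antisymm (not_lt.mp fun hlt => (h₂.1 hlt).ne' h) h'))
  refine ⟨lt₁, ?_, lt₂, h₁.1 lt₁⟩
  by_contra! hle
  rcases hle.lt_or_eq with hlt | heq
  · exact (h₂.1 hlt).not_gt lt₂
  · exact (h₂.2 heq).not_gt lt₂
end
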